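/- arXiv:math/0112112 — 3 statements merged into one kernel-verified Lean document; each statement's English description precedes it below -/
import Mathlib

section
/- Let n ≥ 1 and let the symmetric group Sₙ act on T = (ℂˣ)ⁿ by permuting coordinates. The map E : T → ℂⁿ, E(z) = (e₁(z), e₂(z), …, eₙ(z)), given by evaluating the elementary symmetric polynomials at z₁, …, zₙ (regarded as complex numbers), is continuous and constant on Sₙ-orbits, and the induced map from the orbit space T/Sₙ (with the quotient topology) to ℂⁿ is a homeomorphism onto the subspace {w ∈ ℂⁿ : wₙ ≠ 0}. In particular the symmetric product Symⁿ ℂˣ = (ℂˣ)ⁿ/Sₙ is homeomorphic to ℂ^{n−1} × ℂˣ. -/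
/-- The setoid on `Fin n → α` whose classes are the orbits of the symmetric
group `Sₙ` permuting the coordinates. -/
def permSetoid (n : ℕ) (α : Type*) : Setoid (Fin n → α) where
  r x y := ∃ σ : Equiv.Perm (Fin n), x ∘ ⇑σ = y
  iseqv := by
    refine ⟨fun x => ⟨1, rfl⟩, ?_, ?_⟩
    · rintro x y ⟨σ, rfl⟩
      exact ⟨σ⁻¹, by ext i; simp⟩
    · rintro x y z ⟨σ, rfl⟩ ⟨τ, rfl⟩
      exact ⟨σ * τ, by ext i; simp [Equiv.Perm.mul_apply]⟩

/-- The map `E : (ℂˣ)ⁿ → ℂⁿ` evaluating the elementary symmetric polynomials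
`e₁, …, eₙ` at `z₁, …, zₙ`. -/
noncomputable def esymmMap (n : ℕ) (z : Fin n → {w : ℂ // w ≠ 0}) : Fin n → ℂ :=
  fun k => MvPolynomial.eval (fun i => (z i : ℂ)) (MvPolynomial.esymm (Fin n) ℂ ((k : ℕ) + 1))

open Polynomial in
/-- The monic polynomial with prescribed elementary symmetric functions of its roots. -/
noncomputable def vietaPoly (n : ℕ) (w : Fin n → ℂ) : Polynomial ℂ :=
  X ^ n + ∑ j : Fin n, C ((-1) ^ (n - (j : ℕ)) * w j.rev) * X ^ (j : ℕ)

/-- Elementary symmetric functions on all of `ℂⁿ`. -/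
noncomputable def fullMap (n : ℕ) (z : Fin n → ℂ) : Fin n → ℂ :=
  fun k => MvPolynomial.eval z (MvPolynomial.esymm (Fin n) ℂ ((k : ℕ) + 1))

lemma fullMap_eq (n : ℕ) (z : Fin n → ℂ) (k : Fin n) :
    fullMap n z k = (Finset.univ.val.map z).esymm ((k : ℕ) + 1) := by
  rw [← MvPolynomial.aeval_esymm_eq_multiset_esymm (Fin n) ℂ]
  rfl

lemma exists_perm_of_map_eq {α : Type*} (n : ℕ) (f g : Fin n → α)
    (h : Finset.univ.val.map f = Finset.univ.val.map g) :
    ∃ σ : Equiv.Perm (Fin n), f ∘ ⇑σ = g := by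
  classical
  have hc : ∀ a, Nonempty ({i // g i = a} ≃ {i // f i = a}) := by
    intro a
    rw [← Fintype.card_eq]
    have := congrArg (Multiset.count a) h
    rw [Multiset.count_map, Multiset.count_map] at this
    rw [Fintype.card_subtype, Fintype.card_subtype]
    simp only [eq_comm (a := a)] at this
    exact this.symm
  have e := fun a => (hc a).some
  refine ⟨((Equiv.sigmaFiberEquiv g).symm.trans (Equiv.sigmaCongrRight e)).trans
    (Equiv.sigmaFiberEquiv f), ?_⟩
  ext i
  simp only [Function.comp, Equiv.trans_apply]
  exact (e (g i) ⟨i, rfl⟩).2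

lemma vietaPoly_coeff (n : ℕ) (w : Fin n → ℂ) (j : Fin n) :
    (vietaPoly n w).coeff j = (-1) ^ (n - (j : ℕ)) * w j.rev := by
  have : (j : ℕ) ≠ n := j.2.ne
  simp only [vietaPoly, Polynomial.coeff_add, Polynomial.coeff_X_pow, this, if_false, zero_add,
    Polynomial.finsetSum_coeff, Polynomial.coeff_C_mul]
  rw [Finset.sum_eq_single j]
  · simp
  · intro b _ hb
    have : (j : ℕ) ≠ b := fun h => hb (Fin.ext h.symm)
    simp [this]
  · simp

lemma vietaPoly_monic (n : ℕ) (w : Fin n → ℂ) : (vietaPoly n w).Monic :=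
  Polynomial.monic_X_pow_add (Polynomial.degree_sum_fin_lt _)

lemma vietaPoly_natDegree (n : ℕ) (w : Fin n → ℂ) : (vietaPoly n w).natDegree = n := by
  refine Polynomial.natDegree_eq_of_degree_eq_some ?_
  rw [vietaPoly, Polynomial.degree_add_eq_left_of_degree_lt, Polynomial.degree_X_pow]
  rw [Polynomial.degree_X_pow]
  exact Polynomial.degree_sum_fin_lt _

lemma vietaPoly_inj (n : ℕ) (w w' : Fin n → ℂ) (h : vietaPoly n w = vietaPoly n w') : w = w' := by
  ext k
  have := congrArg (fun p => Polynomial.coeff p (k.rev : ℕ)) h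
  simp only [vietaPoly_coeff, Fin.rev_rev] at this
  exact mul_left_cancel₀ (pow_ne_zero _ (by norm_num)) this

lemma prod_eq_vietaPoly (n : ℕ) (z : Fin n → ℂ) :
    ((Finset.univ.val.map z).map fun t => Polynomial.X - Polynomial.C t).prod
      = vietaPoly n (fullMap n z) := by
  rw [Multiset.prod_X_sub_X_eq_sum_esymm, Finset.sum_range_succ']
  simp only [Multiset.card_map, Finset.card_val, Finset.card_univ, Fintype.card_fin]
  rw [vietaPoly, add_comm]
  congr 1
  · simp [Multiset.esymm]
  · rw [Finset.sum_range, ← Equiv.sum_comp Fin.revPerm]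
    refine Finset.sum_congr rfl fun j _ => ?_
    have h1 : ((j.rev : Fin n) : ℕ) + 1 = n - j := by rw [Fin.val_rev]; omega
    have h2 : n - (n - (j : ℕ)) = j := by omega
    rw [fullMap_eq, Fin.revPerm_apply, h1, h2]
    simp [mul_assoc]

lemma fullMap_fiber (n : ℕ) (z z' : Fin n → ℂ) (h : fullMap n z = fullMap n z') :
    ∃ σ : Equiv.Perm (Fin n), z ∘ ⇑σ = z' := by
  apply exists_perm_of_map_eq
  rw [← Polynomial.roots_multiset_prod_X_sub_C (Finset.univ.val.map z), prod_eq_vietaPoly, h,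
    ← prod_eq_vietaPoly, Polynomial.roots_multiset_prod_X_sub_C]

lemma fullMap_surj (n : ℕ) : Function.Surjective (fullMap n) := by
  intro w
  have hs := IsAlgClosed.splits (vietaPoly n w)
  have hc : (vietaPoly n w).roots.toList.length = n := by
    rw [Multiset.length_toList, ← hs.natDegree_eq_card_roots, vietaPoly_natDegree]
  refine ⟨fun i => (vietaPoly n w).roots.toList.get (i.cast hc.symm), ?_⟩
  apply vietaPoly_inj
  rw [← prod_eq_vietaPoly]
  conv_rhs => rw [hs.eq_prod_roots_of_monic (vietaPoly_monic n w)]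
  congr 2
  rw [Fin.univ_val_map]
  conv_rhs => rw [← Multiset.coe_toList (vietaPoly n w).roots]
  congr 1
  apply List.ext_get
  · simp [hc]
  · intro i h1 h2
    simp

lemma fullMap_continuous (n : ℕ) : Continuous (fullMap n) :=
  continuous_pi fun _ => MvPolynomial.continuous_eval _

lemma fullMap_bound (n : ℕ) (z : Fin n → ℂ) (R : ℝ) (hR : ‖fullMap n z‖ ≤ R) :
    ‖z‖ ≤ 1 + n * R := by
  have hR0 : 0 ≤ R := (norm_nonneg _).trans hR
  have hb : 0 ≤ n * R := by positivity
  refine (pi_norm_le_iff_of_nonneg (by positivity)).2 fun i => ?_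
  by_contra! hlt
  have h1 : 1 ≤ ‖z i‖ := by linarith
  have hroot : (vietaPoly n (fullMap n z)).eval (z i) = 0 := by
    rw [← prod_eq_vietaPoly, ← Polynomial.IsRoot.def, ← Polynomial.mem_roots
      (Polynomial.monic_multisetProd_X_sub_C _).ne_zero, Polynomial.roots_multiset_prod_X_sub_C]
    simp
  rw [vietaPoly] at hroot
  simp only [Polynomial.eval_add, Polynomial.eval_pow, Polynomial.eval_X,
    Polynomial.eval_finsetSum, Polynomial.eval_mul, Polynomial.eval_C] at hroot
  have h2 := eq_neg_of_add_eq_zero_left hroot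
  have h3 : ‖z i‖ ^ n ≤ n * (R * ‖z i‖ ^ (n - 1)) := by
    rw [← norm_pow, h2, norm_neg]
    refine (norm_sum_le _ _).trans ?_
    refine (Finset.sum_le_card_nsmul _ _ (R * ‖z i‖ ^ (n - 1)) ?_).trans (by simp)
    intro j _
    rw [norm_mul, norm_mul, norm_pow, norm_pow, norm_neg, norm_one, one_pow, one_mul]
    gcongr
    · exact (norm_le_pi_norm _ _).trans hR
    · omega
  have hn : n = (n - 1) + 1 := by have := i.2; omega
  have h4 : ‖z i‖ ^ n = ‖z i‖ * ‖z i‖ ^ (n - 1) := by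
    conv_lhs => rw [hn, pow_succ']
  rw [h4, ← mul_assoc] at h3
  have := le_of_mul_le_mul_right h3 (by positivity)
  linarith

lemma fullMap_isClosedMap (n : ℕ) : IsClosedMap (fullMap n) := by
  have : IsProperMap (fullMap n) := by
    rw [isProperMap_iff_isCompact_preimage]
    refine ⟨fullMap_continuous n, fun K hK => ?_⟩
    obtain ⟨R, hR⟩ := hK.isBounded.exists_norm_le
    refine Metric.isCompact_of_isClosed_isBounded
      (hK.isClosed.preimage (fullMap_continuous n)) ?_
    exact isBounded_iff_forall_norm_le.2 ⟨1 + n * R, fun z hz => fullMap_bound n z R (hR _ hz)⟩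
  exact this.isClosedMap

lemma fullMap_last (n : ℕ) (hn : n - 1 < n) (z : Fin n → ℂ) :
    fullMap n z ⟨n - 1, hn⟩ = ∏ i, z i := by
  have h : n - 1 + 1 = n := by omega
  have h2 : Finset.powersetCard n (Finset.univ : Finset (Fin n)) = {Finset.univ} := by
    have := Finset.powersetCard_self (Finset.univ : Finset (Fin n))
    rwa [Finset.card_fin] at this
  simp only [fullMap, h, MvPolynomial.esymm]
  rw [h2]
  simp

/-- The last-coordinate splitting. -/
noncomputable def lastHomeo (m : ℕ) : {w : Fin (m + 1) → ℂ // w (Fin.last m) ≠ 0} ≃ₜ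
    ((Fin m → ℂ) × {w : ℂ // w ≠ 0}) where
  toFun w := (fun i => w.1 i.castSucc, ⟨w.1 (Fin.last m), w.2⟩)
  invFun p := ⟨Fin.snoc (α := fun _ => ℂ) p.1 p.2.1, by simpa using p.2.2⟩
  left_inv w := by
    apply Subtype.ext
    funext i
    refine Fin.lastCases ?_ (fun j => ?_) i <;> simp
  right_inv p := by
    ext <;> simp
  continuous_toFun := by
    refine Continuous.prodMk (continuous_pi fun i => ?_) (Continuous.subtype_mk ?_ _)
    · exact (continuous_apply _).comp continuous_subtype_val
    · exact (continuous_apply _).comp continuous_subtype_val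
  continuous_invFun := by
    refine Continuous.subtype_mk ?_ _
    exact Continuous.finSnoc (A := fun _ => ℂ) continuous_fst
      (continuous_subtype_val.comp continuous_snd)


/-- the map `E(z) = (e₁(z), …, eₙ(z))` on the torus
`T = (ℂˣ)ⁿ` is continuous and constant on `Sₙ`-orbits, and the induced map on
the orbit space `T/Sₙ` is a homeomorphism onto the subspace
`{w ∈ ℂⁿ : wₙ ≠ 0}`.  In particular `Symⁿ ℂˣ = (ℂˣ)ⁿ/Sₙ` is homeomorphic to
`ℂ^{n−1} × ℂˣ`. -/
theorem statement3 (n : ℕ) (hn : 1 ≤ n) :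
    Continuous (esymmMap n) ∧
    (∀ (x : Fin n → {w : ℂ // w ≠ 0}) (σ : Equiv.Perm (Fin n)),
        esymmMap n (x ∘ ⇑σ) = esymmMap n x) ∧
    (∃ F : Quotient (permSetoid n {w : ℂ // w ≠ 0}) ≃ₜ
        {w : Fin n → ℂ // w ⟨n - 1, by omega⟩ ≠ 0},
      ∀ z : Fin n → {w : ℂ // w ≠ 0},
        (F (Quotient.mk (permSetoid n {w : ℂ // w ≠ 0}) z) : Fin n → ℂ) = esymmMap n z) ∧
    Nonempty (Quotient (permSetoid n {w : ℂ // w ≠ 0}) ≃ₜ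
        ((Fin (n - 1) → ℂ) × {w : ℂ // w ≠ 0})) := by
  have hcont : Continuous (esymmMap n) :=
    (fullMap_continuous n).comp
      (continuous_pi fun i => continuous_subtype_val.comp (continuous_apply i))
  have hinv : ∀ (x : Fin n → {w : ℂ // w ≠ 0}) (σ : Equiv.Perm (Fin n)),
        esymmMap n (x ∘ ⇑σ) = esymmMap n x := by
    intro x σ
    funext k
    have := MvPolynomial.eval_rename (σ : Fin n → Fin n) (fun i => (x i : ℂ))
      (MvPolynomial.esymm (Fin n) ℂ ((k : ℕ) + 1))
    rw [MvPolynomial.rename_esymm] at this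
    exact this.symm
  have hne : ∀ z, esymmMap n z ⟨n - 1, by omega⟩ ≠ 0 := by
    intro z
    have := fullMap_last n (by omega) (fun i => (z i : ℂ))
    change fullMap n (fun i => (z i : ℂ)) ⟨n - 1, by omega⟩ ≠ 0
    rw [this]
    exact Finset.prod_ne_zero_iff.2 fun i _ => (z i).2
  let E : (Fin n → {w : ℂ // w ≠ 0}) → {w : Fin n → ℂ // w ⟨n - 1, by omega⟩ ≠ 0} :=
    fun z => ⟨esymmMap n z, hne z⟩
  have hE : Continuous E := hcont.subtype_mk _
  have hlift : ∀ w : Fin n → ℂ, fullMap n w ⟨n - 1, by omega⟩ ≠ 0 → ∀ i, w i ≠ 0 := by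
    intro w hw i
    rw [fullMap_last n (by omega)] at hw
    exact Finset.prod_ne_zero_iff.1 hw i (Finset.mem_univ i)
  have hEsurj : Function.Surjective E := by
    rintro ⟨w, hw⟩
    obtain ⟨z, rfl⟩ := fullMap_surj n w
    exact ⟨fun i => ⟨z i, hlift z hw i⟩, rfl⟩
  have hEclosed : IsClosedMap E := by
    intro S hS
    have hind : Topology.IsInducing (fun (z : Fin n → {w : ℂ // w ≠ 0}) (i : Fin n) => (z i : ℂ)) :=
      Topology.IsInducing.piMap fun _ => Topology.IsInducing.subtypeVal
    obtain ⟨S', hS', rfl⟩ := hind.isClosed_iff.1 hS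
    have : E '' ((fun (z : Fin n → {w : ℂ // w ≠ 0}) (i : Fin n) => (z i : ℂ)) ⁻¹' S') =
        Subtype.val ⁻¹' (fullMap n '' S') := by
      ext ⟨w, hw⟩
      constructor
      · rintro ⟨z, hz, h⟩
        exact ⟨_, hz, congrArg Subtype.val h⟩
      · rintro ⟨z, hz, h⟩
        change fullMap n z = w at h
        subst h
        exact ⟨fun i => ⟨z i, hlift z hw i⟩, hz, rfl⟩
    rw [this]
    exact (fullMap_isClosedMap n _ hS').preimage continuous_subtype_val
  let L : Quotient (permSetoid n {w : ℂ // w ≠ 0}) →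
      {w : Fin n → ℂ // w ⟨n - 1, by omega⟩ ≠ 0} :=
    Quotient.lift E (by
      rintro x y ⟨σ, rfl⟩
      exact Subtype.ext (hinv x σ).symm)
  have hLcont : Continuous L := hE.quotient_lift _
  have hLinj : Function.Injective L := by
    intro a b
    induction a using Quotient.inductionOn with | _ x
    induction b using Quotient.inductionOn with | _ y
    intro h
    obtain ⟨σ, hσ⟩ := fullMap_fiber n (fun i => (x i : ℂ)) (fun i => (y i : ℂ))
      (congrArg Subtype.val h)
    refine Quotient.sound ⟨σ, ?_⟩
    funext i
    exact Subtype.ext (congrFun hσ i)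
  have hLsurj : Function.Surjective L := by
    intro w
    obtain ⟨z, hz⟩ := hEsurj w
    exact ⟨Quotient.mk _ z, hz⟩
  have hLclosed : IsClosedMap L := by
    intro S hS
    have : L '' S = E '' (Quotient.mk (permSetoid n {w : ℂ // w ≠ 0}) ⁻¹' S) := by
      ext w
      constructor
      · rintro ⟨q, hq, rfl⟩
        induction q using Quotient.inductionOn with | _ x
        exact ⟨x, hq, rfl⟩
      · rintro ⟨x, hx, rfl⟩
        exact ⟨_, hx, rfl⟩
    rw [this]
    exact hEclosed _ (hS.preimage continuous_quotient_mk')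
  let F := (Equiv.ofBijective L ⟨hLinj, hLsurj⟩).toHomeomorphOfContinuousClosed hLcont hLclosed
  refine ⟨hcont, hinv, ⟨F, fun z => rfl⟩, ?_⟩
  obtain ⟨m, rfl⟩ : ∃ m, n = m + 1 := ⟨n - 1, by omega⟩
  exact ⟨F.trans (lastHomeo m)⟩
end

section
/- Let k ≥ 1 and let l₁, …, l_k ≥ 1 be natural numbers, and set l = (l₁ − 1) + (l₂ − 1) + ⋯ + (l_k − 1). Then the product of symmetric products Sym^{l₁} ℂˣ × Sym^{l₂} ℂˣ × ⋯ × Sym^{l_k} ℂˣ, where Sym^{m} ℂˣ denotes the orbit space (ℂˣ)^m/S_m with the quotient topology, is homeomorphic to ℂ^l × (ℂˣ)^k, the product of a complex affine space of dimension l and a complex torus of dimension k. -/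
open Polynomial in
/-- The monic polynomial with prescribed roots. -/
noncomputable def rootPoly {m : ℕ} (x : Fin m → ℂ) : Polynomial ℂ := ∏ j, (X - C (x j))

lemma rootPoly_monic {m : ℕ} (x : Fin m → ℂ) : (rootPoly x).Monic :=
  Polynomial.monic_prod_X_sub_C _ _

lemma rootPoly_natDegree {m : ℕ} (x : Fin m → ℂ) : (rootPoly x).natDegree = m := by
  simp [rootPoly, Polynomial.natDegree_finsetProd_X_sub_C_eq_card]

lemma rootPoly_roots {m : ℕ} (x : Fin m → ℂ) :
    (rootPoly x).roots = Finset.univ.val.map x := by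
  have := Polynomial.roots_multiset_prod_X_sub_C (Finset.univ.val.map x)
  rw [← this, Multiset.map_map]
  rfl

lemma rootPoly_coeff_continuous {m : ℕ} (i : ℕ) :
    Continuous (fun x : Fin m → ℂ => (rootPoly x).coeff i) := by
  unfold rootPoly
  generalize (Finset.univ : Finset (Fin m)) = s
  induction s using Finset.induction_on generalizing i with
  | empty => simpa using continuous_const
  | insert a s ha ih =>
    simp only [Finset.prod_insert ha, Polynomial.coeff_mul]
    refine continuous_finsetSum _ fun p _ => Continuous.mul ?_ (ih _)
    simp only [Polynomial.coeff_sub, Polynomial.coeff_C]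
    refine continuous_const.sub ?_
    split_ifs
    · exact continuous_apply a
    · exact continuous_const

lemma perm_of_map_eq {m : ℕ} {α : Type*} (x y : Fin m → α)
    (h : Finset.univ.val.map x = Finset.univ.val.map y) :
    ∃ σ : Equiv.Perm (Fin m), x ∘ ⇑σ = y := by
  classical
  have key : ∀ c, Nonempty ({a // y a = c} ≃ {a // x a = c}) := fun c => by
    have := congrArg (Multiset.count c) h
    rw [Multiset.count_map, Multiset.count_map] at this
    refine ⟨Fintype.equivOfCardEq ?_⟩
    rw [Fintype.card_subtype, Fintype.card_subtype, Finset.card_def, Finset.card_def,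
      Finset.filter_val, Finset.filter_val]
    simpa [eq_comm] using this.symm
  refine ⟨Equiv.ofFiberEquiv fun c => (key c).some, ?_⟩
  funext i
  exact Equiv.ofFiberEquiv_map (fun c => (key c).some) i

/-- The coefficient map. -/
noncomputable def coeffMap (m : ℕ) (x : Fin m → ℂ) : Fin m → ℂ := fun i => (rootPoly x).coeff i

lemma coeffMap_continuous (m : ℕ) : Continuous (coeffMap m) :=
  continuous_pi fun i => rootPoly_coeff_continuous _

lemma coeffMap_fiber {m : ℕ} {x y : Fin m → ℂ} (h : coeffMap m x = coeffMap m y) :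
    rootPoly x = rootPoly y := by
  ext i
  rcases lt_trichotomy i m with hi | rfl | hi
  · exact congrFun h ⟨i, hi⟩
  · have hx := (rootPoly_monic x).coeff_natDegree
    have hy := (rootPoly_monic y).coeff_natDegree
    rw [rootPoly_natDegree] at hx hy
    rw [hx, hy]
  · rw [Polynomial.coeff_eq_zero_of_natDegree_lt, Polynomial.coeff_eq_zero_of_natDegree_lt] <;>
    rwa [rootPoly_natDegree]

open Polynomial in
lemma coeffMap_surjective (m : ℕ) : Function.Surjective (coeffMap m) := by
  intro c
  set q : Polynomial ℂ := ∑ i : Fin m, C (c i) * X ^ (i : ℕ) with hq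
  have hqd : q.degree < m := Polynomial.degree_sum_fin_lt c
  have hm : (X ^ m + q).Monic := monic_X_pow_add hqd
  have hd : (X ^ m + q).natDegree = m := by
    apply natDegree_eq_of_degree_eq_some
    rw [degree_add_eq_left_of_degree_lt] <;> simp [hqd]
  have hs : (X ^ m + q).Splits := IsAlgClosed.splits _
  have hp := hs.eq_prod_roots_of_monic hm
  have hcard : (X ^ m + q).roots.card = m := by
    rw [← hs.natDegree_eq_card_roots, hd]
  obtain ⟨x, hx⟩ : ∃ x : Fin m → ℂ, Finset.univ.val.map x = (X ^ m + q).roots := by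
    revert hcard
    generalize (X ^ m + q).roots = s
    rintro rfl
    induction s using Quotient.inductionOn with
    | h l => exact ⟨l.get, (Fin.univ_val_map l.get).trans (congrArg _ (List.ofFn_get l))⟩
  refine ⟨x, funext fun i => ?_⟩
  have : rootPoly x = X ^ m + q := by
    rw [hp, ← hx, Multiset.map_map]; rfl
  simp only [coeffMap, this, coeff_add, coeff_X_pow, hq, finsetSum_coeff, coeff_C_mul]
  simp [i.2.ne, Fin.val_inj]

lemma coeffMap_isProper (m : ℕ) : IsProperMap (coeffMap m) := by
  rw [isProperMap_iff_isCompact_preimage]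
  refine ⟨coeffMap_continuous m, fun K hK => ?_⟩
  refine Metric.isCompact_of_isClosed_isBounded (hK.isClosed.preimage (coeffMap_continuous m)) ?_
  obtain ⟨R, hR0, hR⟩ := hK.isBounded.exists_pos_norm_le
  rw [isBounded_iff_forall_norm_le]
  refine ⟨R + 1, fun x hx => ?_⟩
  rw [pi_norm_le_iff_of_nonneg (by linarith)]
  intro i
  have hroot : (rootPoly x).IsRoot (x i) := by
    simp only [rootPoly, Polynomial.IsRoot, Polynomial.eval_prod]
    exact Finset.prod_eq_zero (Finset.mem_univ i) (by simp)
  have hb := hroot.norm_lt_cauchyBound (rootPoly_monic x).ne_zero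
  have hb2 : (rootPoly x).cauchyBound ≤ R.toNNReal + 1 := by
    rw [Polynomial.cauchyBound, (rootPoly_monic x).leadingCoeff, rootPoly_natDegree]
    simp only [nnnorm_one, div_one]
    gcongr
    refine Finset.sup_le fun j hj => ?_
    rw [← NNReal.coe_le_coe, Real.coe_toNNReal _ hR0.le, coe_nnnorm]
    exact (norm_le_pi_norm (coeffMap m x) ⟨j, Finset.mem_range.1 hj⟩).trans (hR _ hx)
  have := NNReal.coe_le_coe.2 (hb.le.trans hb2)
  simpa [hR0.le] using this

lemma coeffMap_zero {n : ℕ} (x : Fin (n + 1) → ℂ) :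
    coeffMap (n + 1) x 0 ≠ 0 ↔ ∀ i, x i ≠ 0 := by
  have : coeffMap (n + 1) x 0 = ∏ i, (- x i) := by
    simp [coeffMap, rootPoly, Polynomial.coeff_zero_eq_eval_zero, Polynomial.eval_prod]
  rw [this, Finset.prod_ne_zero_iff]
  simp

/-- The coefficient map on `(ℂˣ)^(n+1)`. -/
noncomputable def unitMap (n : ℕ) (x : Fin (n + 1) → {w : ℂ // w ≠ 0}) :
    {w : ℂ // w ≠ 0} × (Fin n → ℂ) :=
  (⟨coeffMap (n + 1) (fun i => (x i : ℂ)) 0, (coeffMap_zero _).2 fun i => (x i).2⟩,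
    fun i => coeffMap (n + 1) (fun i => (x i : ℂ)) i.succ)

lemma unitMap_eq_iff (n : ℕ) (x : Fin (n + 1) → {w : ℂ // w ≠ 0}) (t : Fin (n + 1) → ℂ)
    (p : {w : ℂ // w ≠ 0} × (Fin n → ℂ)) :
    unitMap n x = p ↔ coeffMap (n + 1) (fun i => (x i : ℂ)) = Fin.cons (p.1 : ℂ) p.2 := by
  obtain ⟨⟨a, ha⟩, b⟩ := p
  simp [unitMap, funext_iff, Fin.forall_fin_succ (n := n), Prod.ext_iff]

lemma exists_lift {n : ℕ} {t : Fin (n + 1) → ℂ} {p : {w : ℂ // w ≠ 0} × (Fin n → ℂ)}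
    (h : coeffMap (n + 1) t = Fin.cons (p.1 : ℂ) p.2) : ∀ i, t i ≠ 0 := by
  rw [← coeffMap_zero, h]
  exact p.1.2

lemma unitMap_isQuotientMap (n : ℕ) : Topology.IsQuotientMap (unitMap n) := by
  have hι : Continuous fun (x : Fin (n + 1) → {w : ℂ // w ≠ 0}) (i : Fin (n + 1)) => (x i : ℂ) := by
    fun_prop
  have hind : Topology.IsInducing
      fun (x : Fin (n + 1) → {w : ℂ // w ≠ 0}) (i : Fin (n + 1)) => (x i : ℂ) :=
    Topology.IsInducing.piMap fun _ => Topology.IsInducing.subtypeVal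
  have hc := (coeffMap_continuous (n + 1)).comp hι
  apply IsClosedMap.isQuotientMap
  · intro S hS
    obtain ⟨T, hT, rfl⟩ := hind.isClosed_iff.1 hS
    have hcl := (coeffMap_isProper (n + 1)).isClosedMap T hT
    have hφ : Continuous fun p : {w : ℂ // w ≠ 0} × (Fin n → ℂ) =>
        (Fin.cons (p.1 : ℂ) p.2 : Fin (n + 1) → ℂ) := by
      refine continuous_pi fun i => ?_
      refine Fin.cases ?_ (fun j => ?_) i
      · simp only [Fin.cons_zero]; fun_prop
      · simp only [Fin.cons_succ]; fun_prop
    convert hcl.preimage hφ using 1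
    ext p
    simp only [Set.mem_image, Set.mem_preimage]
    constructor
    · rintro ⟨x, hx, h⟩
      exact ⟨_, hx, (unitMap_eq_iff n x 0 p).1 h⟩
    · rintro ⟨t, ht, h⟩
      exact ⟨fun i => ⟨t i, exists_lift h i⟩, ht, (unitMap_eq_iff n _ 0 p).2 h⟩
  · refine Continuous.prodMk (Continuous.subtype_mk ((continuous_apply 0).comp hc) _) ?_
    exact continuous_pi fun i => (continuous_apply i.succ).comp hc
  · intro p
    obtain ⟨t, h⟩ := coeffMap_surjective (n + 1) (Fin.cons (p.1 : ℂ) p.2)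
    exact ⟨fun i => ⟨t i, exists_lift h i⟩, (unitMap_eq_iff n _ 0 p).2 h⟩

lemma unitMap_ker (n : ℕ) (x y : Fin (n + 1) → {w : ℂ // w ≠ 0}) :
    permSetoid (n + 1) _ x y ↔ Setoid.ker (unitMap n) x y := by
  rw [Setoid.ker_def]
  constructor
  · rintro ⟨σ, rfl⟩
    have : rootPoly (fun i => ((x ∘ σ) i : ℂ)) = rootPoly (fun i => (x i : ℂ)) := by
      simp only [rootPoly, Function.comp]
      exact Equiv.prod_comp σ (fun i => Polynomial.X - Polynomial.C (x i : ℂ))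
    simp only [unitMap, coeffMap, this]
  · intro h
    have h1 := (unitMap_eq_iff n x 0 _).1 h
    have h2 := (unitMap_eq_iff n y 0 _).1 rfl
    have h3 := coeffMap_fiber (h1.trans h2.symm)
    have h4 := congrArg Polynomial.roots h3
    rw [rootPoly_roots, rootPoly_roots] at h4
    obtain ⟨σ, hσ⟩ := perm_of_map_eq _ _ h4
    exact ⟨σ, funext fun i => Subtype.ext (congrFun hσ i)⟩

/-- One symmetric product. -/
noncomputable def symHomeo (n : ℕ) :
    Quotient (permSetoid (n + 1) {w : ℂ // w ≠ 0}) ≃ₜ {w : ℂ // w ≠ 0} × (Fin n → ℂ) :=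
  (Homeomorph.Quotient.congrRight (unitMap_ker n)).trans
    (Topology.IsQuotientMap.homeomorph (f := ⟨unitMap n, (unitMap_isQuotientMap n).continuous⟩)
      (unitMap_isQuotientMap n))

lemma symHomeo' (m : ℕ) (hm : 1 ≤ m) :
    Nonempty (Quotient (permSetoid m {w : ℂ // w ≠ 0}) ≃ₜ {w : ℂ // w ≠ 0} × (Fin (m - 1) → ℂ)) := by
  obtain ⟨n, rfl⟩ : ∃ n, m = n + 1 := ⟨m - 1, by omega⟩
  exact ⟨symHomeo n⟩

/-- Rearranging the factors. -/
def rearrange {k : ℕ} (d : Fin k → ℕ) (U : Type) [TopologicalSpace U] :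
    ((j : Fin k) → U × (Fin (d j) → ℂ)) ≃ₜ
      (((p : (j : Fin k) × Fin (d j)) → ℂ) × (Fin k → U)) where
  toFun f := (fun p => (f p.1).2 p.2, fun j => (f j).1)
  invFun g := fun j => (g.2 j, fun i => g.1 ⟨j, i⟩)
  left_inv _ := rfl
  right_inv _ := rfl
  continuous_toFun := by fun_prop
  continuous_invFun := by fun_prop

/-- for `k ≥ 1` and `l₁, …, l_k ≥ 1`, with
`l = (l₁ − 1) + ⋯ + (l_k − 1)`, the product of symmetric products
`Sym^{l₁} ℂˣ × ⋯ × Sym^{l_k} ℂˣ` (each `Sym^m ℂˣ = (ℂˣ)^m/S_m` with the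
quotient topology) is homeomorphic to `ℂ^l × (ℂˣ)^k`. -/
theorem statement4 (k : ℕ) (hk : 1 ≤ k) (l : Fin k → ℕ) (hl : ∀ j, 1 ≤ l j)
    (L : ℕ) (hL : L = ∑ j, (l j - 1)) :
    Nonempty (((j : Fin k) → Quotient (permSetoid (l j) {w : ℂ // w ≠ 0})) ≃ₜ
      ((Fin L → ℂ) × (Fin k → {w : ℂ // w ≠ 0}))) := by
  subst hL
  exact ⟨(Homeomorph.piCongrRight fun j => (symHomeo' (l j) (hl j)).some).trans
    ((rearrange (fun j => l j - 1) _).trans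
      ((Homeomorph.piCongrLeft (Y := fun _ => ℂ) finSigmaFinEquiv).prodCongr
        (Homeomorph.refl _)))⟩
end

section
/- Let n ≥ 1 and let R = ℂ[x₁^{±1}, …, xₙ^{±1}] be the Laurent polynomial algebra in n variables over ℂ, with the symmetric group Sₙ acting by permuting the variables. Then the invariant subalgebra R^{Sₙ} is a smooth ℂ-algebra: it is a finitely generated (finite type) ℂ-algebra, it is reduced (indeed an integral domain), and it is formally smooth over ℂ. -/
/-- The automorphism of `ℤⁿ` (= `Fin n → ℤ`, the exponent group of the Laurent
polynomial algebra) given by permuting the coordinates by `σ`. -/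
def permAddEquiv {n : ℕ} (σ : Equiv.Perm (Fin n)) : (Fin n → ℤ) ≃+ (Fin n → ℤ) :=
  { Equiv.piCongrLeft' (fun _ => ℤ) σ with map_add' := fun _ _ => rfl }

/-- The `ℂ`-algebra automorphism of the Laurent polynomial algebra
`ℂ[x₁^{±1}, …, xₙ^{±1}]` (the group algebra of `ℤⁿ` over `ℂ`) permuting the
variables by `σ`. -/
noncomputable def permAut {n : ℕ} (σ : Equiv.Perm (Fin n)) :
    AddMonoidAlgebra ℂ (Fin n → ℤ) ≃ₐ[ℂ] AddMonoidAlgebra ℂ (Fin n → ℤ) :=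
  AddMonoidAlgebra.domCongr ℂ ℂ (permAddEquiv σ)

/-- The invariant subalgebra `R^{Sₙ}` of the Laurent polynomial algebra under
the symmetric group `Sₙ` permuting the variables. -/
noncomputable def laurentInvariants (n : ℕ) :
    Subalgebra ℂ (AddMonoidAlgebra ℂ (Fin n → ℤ)) :=
  ⨅ σ : Equiv.Perm (Fin n),
    AlgHom.equalizer (permAut σ).toAlgHom (AlgHom.id ℂ (AddMonoidAlgebra ℂ (Fin n → ℤ)))

/-- Inclusion of exponents `ℕⁿ → ℤⁿ`. -/
def expIncl (n : ℕ) : (Fin n →₀ ℕ) →+ (Fin n → ℤ) where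
  toFun s := fun i => (s i : ℤ)
  map_zero' := by ext; simp
  map_add' := by intros; ext; simp

lemma expIncl_injective (n : ℕ) : Function.Injective (expIncl n) := by
  intro s t h
  ext i
  have := congrFun h i
  simpa [expIncl] using this

/-- Inclusion of polynomials into Laurent polynomials. -/
noncomputable def polyIncl (n : ℕ) :
    MvPolynomial (Fin n) ℂ →ₐ[ℂ] AddMonoidAlgebra ℂ (Fin n → ℤ) :=
  AddMonoidAlgebra.mapDomainAlgHom ℂ ℂ (expIncl n)

lemma polyIncl_injective (n : ℕ) : Function.Injective (polyIncl n) :=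
  AddMonoidAlgebra.mapDomain_injective (expIncl_injective n)

lemma polyIncl_monomial (n : ℕ) (s : Fin n →₀ ℕ) (c : ℂ) :
    polyIncl n (MvPolynomial.monomial s c) = AddMonoidAlgebra.single (expIncl n s) c :=
  AddMonoidAlgebra.mapDomain_single

lemma permAut_single {n : ℕ} (σ : Equiv.Perm (Fin n)) (v : Fin n → ℤ) (c : ℂ) :
    permAut σ (AddMonoidAlgebra.single v c) = AddMonoidAlgebra.single (v ∘ σ.symm) c :=
  AddMonoidAlgebra.domCongr_single _ _ _

lemma polyIncl_rename {n : ℕ} (σ : Equiv.Perm (Fin n)) (p : MvPolynomial (Fin n) ℂ) :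
    polyIncl n (MvPolynomial.rename σ p) = permAut σ (polyIncl n p) := by
  induction p using MvPolynomial.induction_on' with
  | monomial s c =>
    rw [MvPolynomial.rename_monomial, polyIncl_monomial, polyIncl_monomial, permAut_single]
    congr 1
    ext i
    simp [expIncl, Finsupp.mapDomain_equiv_apply]
  | add p q hp hq => simp only [map_add, hp, hq]

lemma mem_laurentInvariants {n : ℕ} (f : AddMonoidAlgebra ℂ (Fin n → ℤ)) :
    f ∈ laurentInvariants n ↔ ∀ σ : Equiv.Perm (Fin n), permAut σ f = f := by
  simp only [laurentInvariants, Algebra.mem_iInf]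
  rfl

/-- The product of all the variables. -/
noncomputable def eProd (n : ℕ) : MvPolynomial (Fin n) ℂ :=
  MvPolynomial.monomial (Finsupp.equivFunOnFinite.symm fun _ => 1) 1

lemma polyIncl_eProd_pow (n N : ℕ) :
    polyIncl n (eProd n ^ N) = AddMonoidAlgebra.single (fun _ => (N : ℤ)) 1 := by
  rw [eProd, MvPolynomial.monomial_pow, polyIncl_monomial]
  congr 1
  · ext i
    simp [expIncl]
  · simp

lemma polyIncl_eProd (n : ℕ) :
    polyIncl n (eProd n) = AddMonoidAlgebra.single (fun _ => (1 : ℤ)) 1 := by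
  simpa using polyIncl_eProd_pow n 1

lemma eProd_symm (n : ℕ) : (eProd n).IsSymmetric := by
  intro σ
  apply polyIncl_injective
  rw [polyIncl_rename, polyIncl_eProd, permAut_single]
  rfl

lemma exists_pow_mul (n : ℕ) (f : AddMonoidAlgebra ℂ (Fin n → ℤ)) :
    ∃ (N : ℕ) (p : MvPolynomial (Fin n) ℂ), f * polyIncl n (eProd n ^ N) = polyIncl n p := by
  induction f using AddMonoidAlgebra.induction_linear with
  | zero => exact ⟨0, 0, by simp⟩
  | add f g hf hg =>
    obtain ⟨N, p, hp⟩ := hf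
    obtain ⟨M, q, hq⟩ := hg
    refine ⟨N + M, p * eProd n ^ M + q * eProd n ^ N, ?_⟩
    rw [map_add, map_mul, map_mul, ← hp, ← hq, pow_add, map_mul]
    ring
  | single v c =>
    refine ⟨∑ i, (v i).natAbs, MvPolynomial.monomial (Finsupp.equivFunOnFinite.symm
      fun i => (v i + ((∑ i, (v i).natAbs : ℕ) : ℤ)).toNat) c, ?_⟩
    rw [polyIncl_eProd_pow, polyIncl_monomial, AddMonoidAlgebra.single_mul_single, mul_one]
    congr 1
    ext i
    have h : (v i).natAbs ≤ ∑ i, (v i).natAbs :=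
      Finset.single_le_sum (f := fun i => (v i).natAbs) (fun _ _ => Nat.zero_le _)
        (Finset.mem_univ i)
    simp only [expIncl, Pi.add_apply, AddMonoidHom.coe_mk, ZeroHom.coe_mk,
      Finsupp.equivFunOnFinite_symm_apply_apply]
    omega

/-- Symmetric polynomials into invariant Laurent polynomials. -/
noncomputable def symIncl (n : ℕ) :
    MvPolynomial.symmetricSubalgebra (Fin n) ℂ →ₐ[ℂ] laurentInvariants n :=
  ((polyIncl n).comp (MvPolynomial.symmetricSubalgebra (Fin n) ℂ).val).codRestrict _ (by
    intro p
    rw [mem_laurentInvariants]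
    intro σ
    have := polyIncl_rename σ p.1
    rw [p.2 σ] at this
    exact this.symm)

lemma symIncl_coe (n : ℕ) (p : MvPolynomial.symmetricSubalgebra (Fin n) ℂ) :
    (symIncl n p : AddMonoidAlgebra ℂ (Fin n → ℤ)) = polyIncl n p.1 := rfl

/-- The product of all the variables, as a symmetric polynomial. -/
noncomputable def eSym (n : ℕ) : MvPolynomial.symmetricSubalgebra (Fin n) ℂ :=
  ⟨eProd n, eProd_symm n⟩

lemma isUnit_symIncl (n : ℕ) : IsUnit (symIncl n (eSym n)) := by
  refine IsUnit.of_mul_eq_one ⟨AddMonoidAlgebra.single (fun _ => (-1 : ℤ)) 1, ?_⟩ ?_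
  · rw [mem_laurentInvariants]
    intro σ
    rw [permAut_single]
    rfl
  · apply Subtype.ext
    rw [MulMemClass.coe_mul, symIncl_coe]
    change polyIncl n (eProd n) * _ = 1
    rw [polyIncl_eProd, AddMonoidAlgebra.single_mul_single, AddMonoidAlgebra.one_def]
    congr 1
    simp

lemma symIncl_surj (n : ℕ) (z : laurentInvariants n) :
    ∃ (N : ℕ) (p : MvPolynomial.symmetricSubalgebra (Fin n) ℂ),
      z * symIncl n (eSym n ^ N) = symIncl n p := by
  obtain ⟨N, p, hp⟩ := exists_pow_mul n z.1
  refine ⟨N, ⟨p, ?_⟩, Subtype.ext hp⟩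
  intro σ
  apply polyIncl_injective
  rw [polyIncl_rename, ← hp, map_mul, (mem_laurentInvariants _).1 z.2 σ, ← polyIncl_rename,
    map_pow, eProd_symm n σ]

lemma smooth_laurentInvariants (n : ℕ) : Algebra.Smooth ℂ (laurentInvariants n) := by
  let : Algebra (MvPolynomial.symmetricSubalgebra (Fin n) ℂ) (laurentInvariants n) :=
    (symIncl n).toRingHom.toAlgebra
  have : IsScalarTower ℂ (MvPolynomial.symmetricSubalgebra (Fin n) ℂ) (laurentInvariants n) :=
    IsScalarTower.of_algebraMap_eq' (symIncl n).comp_algebraMap.symm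
  have hmap : ∀ x, algebraMap (MvPolynomial.symmetricSubalgebra (Fin n) ℂ)
      (laurentInvariants n) x = symIncl n x := fun _ => rfl
  have : IsLocalization.Away (eSym n) (laurentInvariants n) := by
    refine (isLocalization_iff _ _).2 ⟨?_, ?_, ?_⟩
    · rintro ⟨_, N, rfl⟩
      simp only [hmap, map_pow]
      exact (isUnit_symIncl n).pow N
    · intro z
      obtain ⟨N, p, h⟩ := symIncl_surj n z
      exact ⟨(p, ⟨eSym n ^ N, N, rfl⟩), h⟩
    · intro x y h
      have : x = y := Subtype.ext (polyIncl_injective n (congrArg Subtype.val h))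
      exact ⟨1, by rw [this]⟩
  have : Algebra.Smooth ℂ (MvPolynomial (Fin n) ℂ) := ⟨inferInstance, inferInstance⟩
  have : Algebra.Smooth ℂ (MvPolynomial.symmetricSubalgebra (Fin n) ℂ) :=
    Algebra.Smooth.of_equiv (MvPolynomial.esymmAlgEquiv (Fin n) ℂ (Fintype.card_fin n))
  have : Algebra.Smooth (MvPolynomial.symmetricSubalgebra (Fin n) ℂ) (laurentInvariants n) :=
    Algebra.Smooth.of_isLocalization_Away (eSym n)
  exact Algebra.Smooth.comp ℂ (MvPolynomial.symmetricSubalgebra (Fin n) ℂ) _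

/-- the invariant subalgebra `R^{Sₙ}` of the Laurent polynomial
algebra in `n` variables over `ℂ` is a smooth `ℂ`-algebra: it is of finite
type over `ℂ`, reduced (indeed an integral domain), and formally smooth
over `ℂ`. -/
theorem statement5 (n : ℕ) (hn : 1 ≤ n) :
    Algebra.FiniteType ℂ (laurentInvariants n) ∧
    IsReduced (laurentInvariants n) ∧
    IsDomain (laurentInvariants n) ∧
    Algebra.FormallySmooth ℂ (laurentInvariants n) := by
  have h := smooth_laurentInvariants n
  have := h.finitePresentation
  have : IsDomain (AddMonoidAlgebra ℂ (Fin n → ℤ)) := NoZeroDivisors.to_isDomain _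
  have : IsDomain (laurentInvariants n) := inferInstance
  exact ⟨inferInstance, inferInstance, inferInstance, h.formallySmooth⟩
end
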